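/- Let (M, d, μ) be a metric measure space with V(x,r) = μ(B(x,r)) satisfying C_1^{−1}·λ^{γ_1} ≤ V(x, λr)/V(x, r) ≤ C_1·λ^{γ_2} for all x ∈ M, λ > 1 and r > 0, for some C_1 ≥ 1 and γ_2 ≥ γ_1 > 0. Let f: (0,∞) → (0,∞) be increasing with c_3·(R/r)^{δ_1} ≤ f(R)/f(r) ≤ C_4·(R/r)^{δ_2} for all R ≥ r > 0 (c_3 ∈ (0,1], C_4 ≥ 1, δ_2 ≥ δ_1 > 0), extended by f(0) = 0, and let g: (0,∞) → (0,∞) be increasing with g(R)/g(r) ≥ c_5·(R/r)^α for all R ≥ r > 0 (c_5 ∈ (0,1], α > 0), with the convention g(0) = 0. Let p: (0,∞) × M × M → [0,∞) be measurable with C_2^{−1}·(1/V(x, f^{−1}(s)))·1_{{f(d(x,y)) ≤ s}} ≤ p(s; x, y) ≤ C_2·(1/V(x, f^{−1}(s)))·e^{−g(f(d(x,y))/s)} for all s > 0 and x, y ∈ M, for some C_2 ≥ 1. Let φ be a Bernstein function with φ(0) = 0 such that c_7·λ^{β_2}·φ(θ) ≤ φ(λθ) ≤ C_6·λ^{β_1}·φ(θ)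 for all λ ∈ (0,1] and θ > 0, for some 0 < β_1 < β_2 < 1, c_7 ∈ (0,1] and C_6 ≥ 1, with subordinator laws μ_t and subordinated kernel p_φ(t;x,y) = ∫_{(0,∞)} p(s;x,y) μ_t(ds). Then there exist constants 0 < c ≤ C such that for all t > 0 and x, y ∈ M: c·m(t,x,y) ≤ p_φ(t; x, y) ≤ C·m(t,x,y), where m(t,x,y) = min{1/V(x, f^{−1}(1/φ^{−1}(1/t))), t·φ(1/f(d(x,y)))/V(x, d(x,y))}, the second term being interpreted as +∞ when x = y, f^{−1}(u) = inf{r > 0 : f(r) ≥ u} and φ^{−1}(u) = inf{θ > 0 : φ(θ) ≥ u}. -/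

import Mathlib

open MeasureTheory Real Set Classical

noncomputable section

/-- A Bernstein function: continuous on `[0,∞)`, smooth on `(0,∞)`, nonnegative, and
`(-1)^(n-1) φ^(n)(u) ≥ 0` for all `u > 0` and `n ≥ 1`. -/
def IsBernstein (φ : ℝ → ℝ) : Prop :=
  ContinuousOn φ (Set.Ici 0) ∧ ContDiffOn ℝ (⊤ : ℕ∞) φ (Set.Ioi 0) ∧
  (∀ x ∈ Set.Ici (0 : ℝ), 0 ≤ φ x) ∧
  ∀ n : ℕ, 1 ≤ n → ∀ u : ℝ, 0 < u → 0 ≤ (-1 : ℝ) ^ (n - 1) * iteratedDeriv n φ u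

/-- `μ t` is the law of the subordinator with Laplace exponent `φ` at time `t > 0`. -/
def IsSubordinatorLaw (φ : ℝ → ℝ) (μ : ℝ → Measure ℝ) : Prop :=
  ∀ t : ℝ, 0 < t →
    IsProbabilityMeasure (μ t) ∧ μ t (Set.Iio 0) = 0 ∧
    ∀ l : ℝ, 0 ≤ l → (∫ s, Real.exp (-l * s) ∂μ t) = Real.exp (-t * φ l)

/-- Generalized inverse of an increasing function: `f⁻¹(u) = inf {r > 0 : f(r) ≥ u}`. -/
def genInv (f : ℝ → ℝ) (u : ℝ) : ℝ := sInf {r : ℝ | 0 < r ∧ u ≤ f r}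

/-- Stretched exponentials beat powers on `[1, ∞)`. -/
theorem exists_rpow_mul_exp_neg_le (N : ℝ) {a c : ℝ} (ha : 0 < a) (hc : 0 < c) :
    ∃ K : ℝ, 0 < K ∧ ∀ u : ℝ, 1 ≤ u → u ^ N * Real.exp (-(c * u ^ a)) ≤ K := by
  obtain ⟨n, hn⟩ := exists_nat_ge (N / a)
  refine ⟨n.factorial / c ^ n, by positivity, fun u hu => ?_⟩
  have hu0 : 0 < u := by linarith
  have hpow : u ^ N ≤ (u ^ a) ^ n := by
    rw [← Real.rpow_natCast, ← Real.rpow_mul hu0.le]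
    exact Real.rpow_le_rpow_of_exponent_le hu (by rwa [div_le_iff₀' ha] at hn)
  have hexp := Real.pow_div_factorial_le_exp (c * u ^ a) (by positivity) n
  rw [Real.exp_neg, ← div_eq_mul_inv, div_le_div_iff₀ (Real.exp_pos _) (by positivity)]
  rw [div_le_iff₀ (by positivity), mul_pow] at hexp
  calc u ^ N * c ^ n ≤ (u ^ a) ^ n * c ^ n := by gcongr
    _ ≤ n.factorial * Real.exp (c * u ^ a) := by linarith

theorem summable_rpow_mul_exp_neg (b : ℝ) {a c : ℝ} (ha : 0 < a) (ha1 : a ≤ 1) (hc : 0 < c) :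
    Summable fun k : ℕ => ((k : ℝ) + 1) ^ b * Real.exp (-(c * (k : ℝ) ^ a)) := by
  obtain ⟨K, -, hK⟩ := exists_rpow_mul_exp_neg_le (b + 2) ha hc
  have hsum : Summable fun k : ℕ => Real.exp c * K * (1 / ((k : ℝ) + 1) ^ 2) := by
    have h := (summable_nat_add_iff 1).2 (Real.summable_one_div_nat_pow.2 one_lt_two)
    simpa using h.mul_left (Real.exp c * K)
  refine Summable.of_nonneg_of_le (fun k => by positivity) (fun k => ?_) hsum
  have hk : (0 : ℝ) < (k : ℝ) + 1 := by positivity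
  have hsub : ((k : ℝ) + 1) ^ a ≤ (k : ℝ) ^ a + 1 := by
    simpa using Real.rpow_add_le_add_rpow (Nat.cast_nonneg k) zero_le_one ha.le ha1
  have hexp : Real.exp (-(c * (k : ℝ) ^ a)) ≤
      Real.exp c * Real.exp (-(c * ((k : ℝ) + 1) ^ a)) := by
    rw [← Real.exp_add]
    gcongr
    nlinarith
  have h := hK ((k : ℝ) + 1) (by simp)
  rw [Real.rpow_add hk, Real.rpow_two] at h
  rw [mul_one_div, le_div_iff₀ (by positivity)]
  calc ((k : ℝ) + 1) ^ b * Real.exp (-(c * (k : ℝ) ^ a)) * ((k : ℝ) + 1) ^ 2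
      ≤ ((k : ℝ) + 1) ^ b * (Real.exp c * Real.exp (-(c * ((k : ℝ) + 1) ^ a))) *
          ((k : ℝ) + 1) ^ 2 := by gcongr
    _ = Real.exp c * (((k : ℝ) + 1) ^ b * ((k : ℝ) + 1) ^ 2 *
          Real.exp (-(c * ((k : ℝ) + 1) ^ a))) := by ring
    _ ≤ Real.exp c * K := by gcongr

theorem half_le_one_sub_exp_neg {u : ℝ} (hu0 : 0 ≤ u) (hu1 : u ≤ 1) :
    u / 2 ≤ 1 - Real.exp (-u) := by
  have h1 := Real.add_one_le_exp u
  have h2 : Real.exp (-u) ≤ 1 / (1 + u) := by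
    rw [Real.exp_neg, ← one_div]
    exact one_div_le_one_div_of_le (by linarith) (by linarith)
  have h3 : 1 / (1 + u) ≤ 1 - u / 2 := by
    rw [div_le_iff₀ (by linarith)]
    nlinarith
  linarith

theorem one_half_le_one_sub_exp_neg {u : ℝ} (hu : 1 ≤ u) : 1 / 2 ≤ 1 - Real.exp (-u) := by
  have h1 := half_le_one_sub_exp_neg zero_le_one le_rfl
  have h2 : Real.exp (-u) ≤ Real.exp (-1) := Real.exp_le_exp.2 (by linarith)
  linarith

/-- `ν` is a probability measure carried by `[0, ∞)` with Laplace transform `exp (-ψ)`. -/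
structure HasLaplaceExponent (ν : Measure ℝ) (ψ : ℝ → ℝ) : Prop where
  isProbabilityMeasure : IsProbabilityMeasure ν
  measure_Iio : ν (Set.Iio 0) = 0
  integral_exp : ∀ l : ℝ, 0 ≤ l → ∫ s, Real.exp (-l * s) ∂ν = Real.exp (-ψ l)

namespace HasLaplaceExponent

variable {ν : Measure ℝ} {ψ : ℝ → ℝ}

theorem ae_nonneg (h : HasLaplaceExponent ν ψ) : ∀ᵐ s ∂ν, 0 ≤ s := by
  rw [ae_iff]
  simpa [Set.Iio] using h.measure_Iio

theorem integrable_exp (h : HasLaplaceExponent ν ψ) {l : ℝ} (hl : 0 ≤ l) :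
    Integrable (fun s => Real.exp (-l * s)) ν := by
  have := h.isProbabilityMeasure
  refine Integrable.of_bound (by fun_prop) 1 ?_
  filter_upwards [h.ae_nonneg] with s hs
  rw [Real.norm_eq_abs, Real.abs_exp, Real.exp_le_one_iff]
  nlinarith

theorem lintegral_exp (h : HasLaplaceExponent ν ψ) {l : ℝ} (hl : 0 ≤ l) :
    ∫⁻ s, ENNReal.ofReal (Real.exp (-l * s)) ∂ν = ENNReal.ofReal (Real.exp (-ψ l)) := by
  rw [← h.integral_exp l hl, ofReal_integral_eq_lintegral_ofReal (h.integrable_exp hl)]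
  exact Filter.Eventually.of_forall fun s => (Real.exp_pos _).le

theorem integrable_one_sub_exp (h : HasLaplaceExponent ν ψ) {l : ℝ} (hl : 0 ≤ l) :
    Integrable (fun s => 1 - Real.exp (-l * s)) ν := by
  have := h.isProbabilityMeasure
  exact (integrable_const 1).sub (h.integrable_exp hl)

theorem integral_one_sub_exp (h : HasLaplaceExponent ν ψ) {l : ℝ} (hl : 0 ≤ l) :
    ∫ s, (1 - Real.exp (-l * s)) ∂ν = 1 - Real.exp (-ψ l) := by
  have := h.isProbabilityMeasure
  rw [integral_sub (integrable_const 1) (h.integrable_exp hl), h.integral_exp l hl]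
  simp

theorem integral_one_sub_exp_le (h : HasLaplaceExponent ν ψ) {l : ℝ} (hl : 0 ≤ l) :
    ∫ s, (1 - Real.exp (-l * s)) ∂ν ≤ ψ l := by
  rw [h.integral_one_sub_exp hl]
  linarith [Real.one_sub_le_exp_neg (ψ l)]

theorem lintegral_one_sub_exp_le (h : HasLaplaceExponent ν ψ) {l : ℝ} (hl : 0 ≤ l) :
    ∫⁻ s, ENNReal.ofReal (1 - Real.exp (-l * s)) ∂ν ≤ ENNReal.ofReal (ψ l) := by
  rw [← ofReal_integral_eq_lintegral_ofReal (h.integrable_one_sub_exp hl)]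
  · exact ENNReal.ofReal_le_ofReal (h.integral_one_sub_exp_le hl)
  · filter_upwards [h.ae_nonneg] with s hs
    have : Real.exp (-l * s) ≤ 1 := Real.exp_le_one_iff.2 (by nlinarith)
    simpa using this

/-- A measure with vanishing Laplace exponent does not charge `(0, ∞)`. -/
theorem measure_Ioi_eq_zero (h : HasLaplaceExponent ν ψ) (hψ : ψ 1 = 0) :
    ν (Set.Ioi 0) = 0 := by
  have hle := h.lintegral_one_sub_exp_le zero_le_one
  rw [hψ, ENNReal.ofReal_zero, nonpos_iff_eq_zero, lintegral_eq_zero_iff (by fun_prop)] at hle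
  refine measure_mono_null (fun s hs => ?_) (ae_iff.1 hle)
  have hs' : Real.exp (-1 * s) < 1 := by
    rw [Real.exp_lt_one_iff]
    simpa using hs
  simpa using hs'

/-- The mass of an annulus `[r, K r)` is bounded below by values of the Laplace exponent. -/
theorem le_measureReal_Ico (h : HasLaplaceExponent ν ψ) {ε K r : ℝ} (hε : 0 < ε) (hK : 1 ≤ K)
    (hr : 0 < r) :
    1 - Real.exp (-ψ (ε / r)) - 2 * ε * ψ (1 / r) - 2 * ψ (1 / (K * r)) ≤
      ν.real (Set.Ico r (K * r)) := by
  have := h.isProbabilityMeasure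
  have hK0 : 0 < K := by linarith
  have i1 := h.integrable_one_sub_exp (l := ε / r) (by positivity)
  have i2 := h.integrable_one_sub_exp (l := 1 / r) (by positivity)
  have i3 := h.integrable_one_sub_exp (l := 1 / (K * r)) (by positivity)
  have e2 := h.integral_one_sub_exp_le (l := 1 / r) (by positivity)
  have e3 := h.integral_one_sub_exp_le (l := 1 / (K * r)) (by positivity)
  have key : ∫ s, ((1 - Real.exp (-(ε / r) * s)) - (2 * ε) * (1 - Real.exp (-(1 / r) * s))
      - 2 * (1 - Real.exp (-(1 / (K * r)) * s))) ∂ν ≤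
      ∫ s, (Set.Ico r (K * r)).indicator (fun _ => (1 : ℝ)) s ∂ν := by
    refine integral_mono_ae ((i1.sub (i2.const_mul _)).sub (i3.const_mul _))
      ((integrable_const 1).indicator measurableSet_Ico) ?_
    filter_upwards [h.ae_nonneg] with s hs
    have hpos : ∀ l : ℝ, 0 ≤ l → 0 ≤ 1 - Real.exp (-l * s) := fun l hl => by
      have : Real.exp (-l * s) ≤ 1 := Real.exp_le_one_iff.2 (by nlinarith)
      linarith
    have p2 := hpos (1 / r) (by positivity)
    have p3 := hpos (1 / (K * r)) (by positivity)
    have q1 := Real.exp_pos (-(ε / r) * s)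
    have p2' : 0 ≤ 2 * ε * (1 - Real.exp (-(1 / r) * s)) := by positivity
    rcases lt_or_ge s r with hsr | hsr
    · rw [Set.indicator_of_notMem (fun hh => hsr.not_ge hh.1)]
      have a1 := half_le_one_sub_exp_neg (u := s / r) (by positivity)
        ((div_le_one hr).2 hsr.le)
      have a2 := Real.add_one_le_exp (-(ε / r) * s)
      have a3 : -(1 / r) * s = -(s / r) := by ring
      have a4 : -(ε / r) * s = -(ε * (s / r)) := by ring
      rw [a3] at p2' ⊢
      rw [a4] at a2 ⊢
      nlinarith
    · rcases lt_or_ge s (K * r) with hsK | hsK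
      · rw [Set.indicator_of_mem (show s ∈ Set.Ico r (K * r) from ⟨hsr, hsK⟩)]
        linarith
      · rw [Set.indicator_of_notMem (fun hh => hsK.not_gt hh.2)]
        have a1 := one_half_le_one_sub_exp_neg (u := s / (K * r))
          ((one_le_div (by positivity)).2 hsK)
        have a3 : -(1 / (K * r)) * s = -(s / (K * r)) := by ring
        rw [a3]
        linarith
  have i12 : Integrable (fun s => (1 - Real.exp (-(ε / r) * s)) -
      (2 * ε) * (1 - Real.exp (-(1 / r) * s))) ν := i1.sub (i2.const_mul _)
  rw [integral_sub i12 (i3.const_mul _), integral_sub i1 (i2.const_mul _), integral_const_mul, integral_const_mul,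
    h.integral_one_sub_exp (by positivity), integral_indicator measurableSet_Ico] at key
  simp only [integral_const, smul_eq_mul, mul_one, measureReal_restrict_apply_univ] at key
  have : 2 * ε * ∫ s, (1 - Real.exp (-(1 / r) * s)) ∂ν ≤ 2 * ε * ψ (1 / r) := by gcongr
  linarith

end HasLaplaceExponent

/-- Under two-sided scaling of the Laplace exponent, an annulus at scale `r` carries mass at least
comparable to `ψ (1 / r)`. -/
theorem exists_le_measureReal_Ico {β₁ β₂ c₇ C₆ : ℝ} (hβ₁ : 0 < β₁) (hβ₂0 : 0 < β₂)
    (hβ₂ : β₂ < 1) (hc₇0 : 0 < c₇) (hc₇1 : c₇ ≤ 1) (hC₆ : 1 ≤ C₆) :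
    ∃ K c : ℝ, 1 ≤ K ∧ 0 < c ∧ ∀ (ν : Measure ℝ) (ψ : ℝ → ℝ), HasLaplaceExponent ν ψ →
      (∀ θ : ℝ, 0 < θ → 0 < ψ θ) → MonotoneOn ψ (Set.Ici 0) →
      (∀ l : ℝ, 0 < l → l ≤ 1 → ∀ θ : ℝ, 0 < θ → c₇ * l ^ β₂ * ψ θ ≤ ψ (l * θ)) →
      (∀ l : ℝ, 0 < l → l ≤ 1 → ∀ θ : ℝ, 0 < θ → ψ (l * θ) ≤ C₆ * l ^ β₁ * ψ θ) →
      ∀ r : ℝ, 0 < r → ψ (1 / r) ≤ 1 → c * ψ (1 / r) ≤ ν.real (Set.Ico r (K * r)) := by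
  have hβ : 0 < 1 - β₂ := by linarith
  obtain ⟨ε, hε0, hε1, hε⟩ : ∃ ε : ℝ, 0 < ε ∧ ε ≤ 1 ∧ 16 * ε = c₇ * ε ^ β₂ := by
    have hpos : 0 < (c₇ / 16) ^ (1 / (1 - β₂)) := by positivity
    refine ⟨(c₇ / 16) ^ (1 / (1 - β₂)), hpos,
      Real.rpow_le_one (by positivity) (by linarith) (by positivity), ?_⟩
    set ε := (c₇ / 16) ^ (1 / (1 - β₂))
    have h1 : ε ^ (1 - β₂) = c₇ / 16 := by
      rw [← Real.rpow_mul (by positivity), one_div_mul_cancel hβ.ne', Real.rpow_one]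
    have h2 : ε = ε ^ (1 - β₂) * ε ^ β₂ := by
      rw [← Real.rpow_add hpos]
      simp
    rw [h1] at h2
    linarith
  have ha : 0 < c₇ * ε ^ β₂ := by positivity
  have ha1 : c₇ * ε ^ β₂ ≤ 1 :=
    mul_le_one₀ hc₇1 (by positivity) (Real.rpow_le_one hε0.le hε1 hβ₂0.le)
  set a := c₇ * ε ^ β₂
  obtain ⟨l, hl0, hl1, hl⟩ : ∃ l : ℝ, 0 < l ∧ l ≤ 1 ∧ 16 * (C₆ * l ^ β₁) = a := by
    refine ⟨(a / (16 * C₆)) ^ (1 / β₁), by positivity,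
      Real.rpow_le_one (by positivity) ?_ (by positivity), ?_⟩
    · rw [div_le_one (by positivity)]
      linarith
    · rw [← Real.rpow_mul (by positivity), one_div_mul_cancel hβ₁.ne', Real.rpow_one]
      field_simp
  refine ⟨1 / l, a / 4, (one_le_div hl0).2 hl1, by positivity, ?_⟩
  intro ν ψ h hpos hmono hup hlo r hr hr1
  have hq : 0 < ψ (1 / r) := hpos _ (by positivity)
  have key := h.le_measureReal_Ico hε0 ((one_le_div hl0).2 hl1) hr
  have s1 := hup ε hε0 hε1 (1 / r) (by positivity)
  have s2 := hlo l hl0 hl1 (1 / r) (by positivity)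
  have e1 : ε * (1 / r) = ε / r := by ring
  have e2 : l * (1 / r) = 1 / (1 / l * r) := by field_simp
  rw [e1] at s1
  rw [e2] at s2
  have hle : ψ (ε / r) ≤ ψ (1 / r) := by
    refine hmono (Set.mem_Ici.2 (by positivity)) (Set.mem_Ici.2 (by positivity)) ?_
    gcongr
  have s3 := half_le_one_sub_exp_neg (hpos (ε / r) (by positivity)).le
    (hle.trans hr1)
  have s4 : C₆ * l ^ β₁ = a / 16 := by linarith
  have s5 : ε = a / 16 := by linarith
  rw [s4] at s2
  have s6 : 2 * ε * ψ (1 / r) = a / 8 * ψ (1 / r) := by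
    rw [s5]
    ring
  rw [s6] at key
  linarith

/-- Negative moments of a law, at the scale `T` at which its Laplace exponent equals one. -/
theorem exists_lintegral_negative_moment_le (b : ℝ) {β₁ C₆ : ℝ} (hb : 0 ≤ b) (hβ₁ : 0 < β₁)
    (hβ₁1 : β₁ ≤ 1) (hC₆ : 1 ≤ C₆) :
    ∃ S : ℝ, 0 < S ∧ ∀ (ν : Measure ℝ) (ψ : ℝ → ℝ), HasLaplaceExponent ν ψ → ψ 0 = 0 →
      (∀ l : ℝ, 0 < l → l ≤ 1 → ∀ θ : ℝ, 0 < θ → ψ (l * θ) ≤ C₆ * l ^ β₁ * ψ θ) →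
      ∀ T : ℝ, 0 < T → ψ (1 / T) = 1 →
        ∫⁻ s in Set.Ioi 0, ENNReal.ofReal (max 1 ((T / s) ^ b)) ∂ν ≤ ENNReal.ofReal S := by
  have hC₆0 : 0 < C₆ := by linarith
  have hsum := (summable_rpow_mul_exp_neg b hβ₁ hβ₁1 (c := 1 / C₆) (by positivity)).mul_left
    (Real.exp 1)
  refine ⟨∑' k : ℕ, Real.exp 1 * (((k : ℝ) + 1) ^ b * Real.exp (-(1 / C₆ * (k : ℝ) ^ β₁))),
    hsum.tsum_pos (fun k => by positivity) 0 (by positivity), ?_⟩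
  intro ν ψ h h0 hlo T hT hψT
  have hgrow : ∀ k : ℕ, 1 / C₆ * (k : ℝ) ^ β₁ ≤ ψ (k / T) := by
    intro k
    rcases Nat.eq_zero_or_pos k with rfl | hk
    · simp [h0, Real.zero_rpow hβ₁.ne']
    · have hk' : (0 : ℝ) < k := by exact_mod_cast hk
      have hk1 : (1 : ℝ) ≤ k := by exact_mod_cast hk
      have := hlo (1 / k) (by positivity) ((div_le_one hk').2 hk1) (k / T) (by positivity)
      have e : 1 / (k : ℝ) * (k / T) = 1 / T := by field_simp
      rw [e, hψT, Real.div_rpow zero_le_one hk'.le, Real.one_rpow] at this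
      rw [one_div_mul_eq_div, div_le_iff₀ hC₆0]
      have hkp : 0 < (k : ℝ) ^ β₁ := by positivity
      have e2 : C₆ * (1 / (k : ℝ) ^ β₁) * ψ (k / T) = C₆ * ψ (k / T) / (k : ℝ) ^ β₁ := by ring
      rw [e2, le_div_iff₀ hkp] at this
      linarith
  have hpt : ∀ s : ℝ, 0 < s → ENNReal.ofReal (max 1 ((T / s) ^ b)) ≤
      ∑' k : ℕ, ENNReal.ofReal (Real.exp 1 * ((k : ℝ) + 1) ^ b) *
        ENNReal.ofReal (Real.exp (-((k : ℝ) / T) * s)) := by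
    intro s hs
    refine le_trans ?_ (ENNReal.le_tsum ⌊T / s⌋₊)
    rw [← ENNReal.ofReal_mul (by positivity)]
    refine ENNReal.ofReal_le_ofReal ?_
    have hfl := Nat.floor_le (show 0 ≤ T / s by positivity)
    have hlt := Nat.lt_floor_add_one (T / s)
    set k := ⌊T / s⌋₊
    have hexp : 1 ≤ Real.exp 1 * Real.exp (-((k : ℝ) / T) * s) := by
      rw [← Real.exp_add, Real.one_le_exp_iff]
      have e : -((k : ℝ) / T) * s = -(k * s / T) := by ring
      rw [le_div_iff₀ hs] at hfl
      have := (div_le_one hT).2 hfl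
      rw [e]
      linarith
    have hmax : max 1 ((T / s) ^ b) ≤ ((k : ℝ) + 1) ^ b := by
      refine max_le (Real.one_le_rpow (by simp) hb) ?_
      exact Real.rpow_le_rpow (by positivity) hlt.le hb
    calc max 1 ((T / s) ^ b) ≤ ((k : ℝ) + 1) ^ b := hmax
      _ ≤ ((k : ℝ) + 1) ^ b * (Real.exp 1 * Real.exp (-((k : ℝ) / T) * s)) :=
          le_mul_of_one_le_right (by positivity) hexp
      _ = _ := by ring
  calc ∫⁻ s in Set.Ioi 0, ENNReal.ofReal (max 1 ((T / s) ^ b)) ∂ν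
      ≤ ∫⁻ s in Set.Ioi 0, ∑' k : ℕ, ENNReal.ofReal (Real.exp 1 * ((k : ℝ) + 1) ^ b) *
          ENNReal.ofReal (Real.exp (-((k : ℝ) / T) * s)) ∂ν :=
        setLIntegral_mono' measurableSet_Ioi hpt
    _ ≤ ∫⁻ s, ∑' k : ℕ, ENNReal.ofReal (Real.exp 1 * ((k : ℝ) + 1) ^ b) *
          ENNReal.ofReal (Real.exp (-((k : ℝ) / T) * s)) ∂ν := setLIntegral_le_lintegral _ _
    _ = ∑' k : ℕ, ENNReal.ofReal (Real.exp 1 * ((k : ℝ) + 1) ^ b) *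
          ENNReal.ofReal (Real.exp (-ψ (k / T))) := by
        rw [lintegral_tsum (fun k => by fun_prop)]
        congr 1 with k
        rw [lintegral_const_mul _ (by fun_prop), h.lintegral_exp (by positivity)]
    _ ≤ ∑' k : ℕ, ENNReal.ofReal
          (Real.exp 1 * (((k : ℝ) + 1) ^ b * Real.exp (-(1 / C₆ * (k : ℝ) ^ β₁)))) := by
        refine ENNReal.tsum_le_tsum fun k => ?_
        rw [← ENNReal.ofReal_mul (by positivity), ← mul_assoc]
        refine ENNReal.ofReal_le_ofReal ?_
        gcongr
        exact hgrow k
    _ = _ := (ENNReal.ofReal_tsum_of_nonneg (fun k => by positivity) hsum).symm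

/-- A kernel profile with stretched exponential decay is dominated by `1 - exp (-s / D)`. -/
theorem exists_exp_neg_div_le {g : ℝ → ℝ} (hgpos : ∀ r : ℝ, 0 < r → 0 < g r) {c₅ α A b : ℝ}
    (hc₅0 : 0 < c₅) (hα : 0 < α)
    (hgscal : ∀ r R : ℝ, 0 < r → r ≤ R → c₅ * (R / r) ^ α ≤ g R / g r) (hA : 0 < A) :
    ∃ B : ℝ, 0 < B ∧ ∀ F : ℝ → ℝ, (∀ s, 0 < s → 0 < F s) → MonotoneOn F (Set.Ioi 0) →
      (∀ s S : ℝ, 0 < s → s ≤ S → F S ≤ A * (S / s) ^ b * F s) →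
      ∀ s D : ℝ, 0 < s → 0 < D →
        Real.exp (-g (D / s)) / F s ≤ B / F D * (1 - Real.exp (-(1 / D) * s)) := by
  have hg1 := hgpos 1 one_pos
  obtain ⟨K, hK, hKle⟩ := exists_rpow_mul_exp_neg_le (b + 1) hα (c := c₅ * g 1) (by positivity)
  refine ⟨2 * (1 + A * K), by positivity, fun F hFpos hFmono hF s D hs hD => ?_⟩
  have hFs := hFpos s hs
  have hFD := hFpos D hD
  have e : -(1 / D) * s = -(s / D) := by ring
  rw [e]
  have hgnn := hgpos (D / s) (by positivity)
  rcases le_or_gt D s with hDs | hDs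
  · have h1 := one_half_le_one_sub_exp_neg ((one_le_div hD).2 hDs)
    have h2 : F D ≤ F s := hFmono hD hs hDs
    have h3 : Real.exp (-g (D / s)) ≤ 1 := Real.exp_le_one_iff.2 (by linarith)
    calc Real.exp (-g (D / s)) / F s ≤ 1 / F D := by gcongr
      _ = (2 * (1 + 0)) / F D * (1 / 2) := by ring
      _ ≤ (2 * (1 + A * K)) / F D * (1 - Real.exp (-(s / D))) := by gcongr; positivity
  · have hu : 1 ≤ D / s := (one_le_div hs).2 hDs.le
    have hu0 : 0 < D / s := by positivity
    have h1 := half_le_one_sub_exp_neg (u := s / D) (by positivity)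
      ((div_le_one hD).2 hDs.le)
    have h2 := hF s D hs hDs.le
    have h3 := hgscal 1 (D / s) one_pos hu
    rw [div_one, le_div_iff₀ hg1] at h3
    have h4 := hKle (D / s) hu
    have h5 : Real.exp (-g (D / s)) ≤ Real.exp (-(c₅ * g 1 * (D / s) ^ α)) := by
      gcongr
      linarith
    have h6 : (D / s) ^ b * Real.exp (-g (D / s)) ≤ K * (s / D) := by
      rw [Real.rpow_add hu0, Real.rpow_one] at h4
      have e2 : s / D = (D / s)⁻¹ := (inv_div D s).symm
      rw [e2, ← div_eq_mul_inv, le_div_iff₀ hu0]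
      calc (D / s) ^ b * Real.exp (-g (D / s)) * (D / s)
          ≤ (D / s) ^ b * Real.exp (-(c₅ * g 1 * (D / s) ^ α)) * (D / s) := by gcongr
        _ ≤ K := by linarith
    rw [div_mul_eq_mul_div, div_le_div_iff₀ hFs hFD]
    calc Real.exp (-g (D / s)) * F D
        ≤ Real.exp (-g (D / s)) * (A * (D / s) ^ b * F s) := by gcongr
      _ = A * ((D / s) ^ b * Real.exp (-g (D / s))) * F s := by ring
      _ ≤ A * (K * (s / D)) * F s := by gcongr
      _ ≤ 2 * (1 + A * K) * (s / D / 2) * F s := by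
          have : 0 ≤ s / D * F s := by positivity
          nlinarith
      _ ≤ 2 * (1 + A * K) * (1 - Real.exp (-(s / D))) * F s := by gcongr

section GenInv

variable {f : ℝ → ℝ} {s r : ℝ}

theorem bddBelow_genInv (f : ℝ → ℝ) (s : ℝ) : BddBelow {r : ℝ | 0 < r ∧ s ≤ f r} :=
  ⟨0, fun _ hr => hr.1.le⟩

theorem genInv_le (hr : 0 < r) (h : s ≤ f r) : genInv f s ≤ r :=
  csInf_le (bddBelow_genInv f s) ⟨hr, h⟩

theorem lt_of_lt_genInv (hr : 0 < r) (h : r < genInv f s) : f r < s := by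
  by_contra! hs
  exact (genInv_le hr hs).not_gt h

/-- The lower scaling condition with exponent `δ` and constant `c`, together with positivity and
monotonicity. -/
structure LowerScaling (f : ℝ → ℝ) (c δ : ℝ) : Prop where
  const_pos : 0 < c
  exponent_pos : 0 < δ
  pos : ∀ r : ℝ, 0 < r → 0 < f r
  mono : MonotoneOn f (Set.Ioi 0)
  scaling : ∀ r R : ℝ, 0 < r → r ≤ R → c * (R / r) ^ δ * f r ≤ f R

namespace LowerScaling

variable {c δ : ℝ}

theorem nonempty (h : LowerScaling f c δ) (s : ℝ) : {r : ℝ | 0 < r ∧ s ≤ f r}.Nonempty := by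
  have hc := h.const_pos
  have hδ := h.exponent_pos
  have h1 := h.pos 1 one_pos
  have hbase : 0 < max 1 (s / (c * f 1)) := lt_max_of_lt_left one_pos
  refine ⟨(max 1 (s / (c * f 1))) ^ (1 / δ), by positivity, ?_⟩
  have hR := h.scaling 1 _ one_pos
    (Real.one_le_rpow (le_max_left 1 (s / (c * f 1))) (by positivity : 0 ≤ 1 / δ))
  rw [div_one, ← Real.rpow_mul hbase.le, one_div_mul_cancel hδ.ne', Real.rpow_one] at hR
  refine le_trans ?_ hR
  have : s / (c * f 1) ≤ max 1 (s / (c * f 1)) := le_max_right _ _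
  rw [div_le_iff₀ (by positivity)] at this
  linarith

theorem le_of_genInv_lt (h : LowerScaling f c δ) (hr : 0 < r) (hlt : genInv f s < r) :
    s ≤ f r := by
  obtain ⟨r', ⟨hr', hs⟩, hlt'⟩ := exists_lt_of_csInf_lt (h.nonempty s) hlt
  exact hs.trans (h.mono hr' hr hlt'.le)

theorem genInv_pos (h : LowerScaling f c δ) (hs : 0 < s) : 0 < genInv f s := by
  have hc := h.const_pos
  have hδ := h.exponent_pos
  have h1 := h.pos 1 one_pos
  set m := max 1 (2 * f 1 / (c * s))
  have hm1 : 1 ≤ m := le_max_left _ _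
  have hm0 : 0 < m := by linarith
  have hR1 : 1 ≤ m ^ (1 / δ) := Real.one_le_rpow hm1 (by positivity)
  have hρ : 0 < 1 / m ^ (1 / δ) := by positivity
  refine hρ.trans_le (le_csInf (h.nonempty s) fun r hr => ?_)
  by_contra! hlt
  have hle := hr.2.trans (h.mono hr.1 hρ hlt.le)
  have hsc := h.scaling (1 / m ^ (1 / δ)) 1 hρ ((div_le_one (by positivity)).2 hR1)
  rw [one_div_one_div, ← Real.rpow_mul hm0.le, one_div_mul_cancel hδ.ne', Real.rpow_one] at hsc
  have hm2 : 2 * f 1 / (c * s) ≤ m := le_max_right _ _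
  rw [div_le_iff₀ (by positivity)] at hm2
  have : c * m * s ≤ c * m * f (1 / m ^ (1 / δ)) := by gcongr
  linarith

theorem genInv_mono (h : LowerScaling f c δ) {S : ℝ} (hS : s ≤ S) :
    genInv f s ≤ genInv f S :=
  csInf_le_csInf (bddBelow_genInv f s) (h.nonempty S) fun _ hr => ⟨hr.1, hS.trans hr.2⟩

/-- Upper scaling of the generalized inverse. -/
theorem genInv_le_mul (h : LowerScaling f c δ) (hc1 : c ≤ 1) (hs : 0 < s) {S : ℝ} (hS : s ≤ S) :
    genInv f S ≤ 2 * (S / (c * s)) ^ (1 / δ) * genInv f s := by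
  have hc := h.const_pos
  have hδ := h.exponent_pos
  have hρ := h.genInv_pos hs
  have hS0 : 0 < S := hs.trans_le hS
  have hq : 1 ≤ S / (c * s) := (one_le_div (by positivity)).2 (by nlinarith)
  have hq' : 1 ≤ (S / (c * s)) ^ (1 / δ) := Real.one_le_rpow hq (by positivity)
  refine genInv_le (by positivity) ?_
  have h2 := h.le_of_genInv_lt (r := 2 * genInv f s) (by positivity) (by linarith)
  have hsc := h.scaling (2 * genInv f s) (2 * (S / (c * s)) ^ (1 / δ) * genInv f s)
    (by positivity) (by nlinarith)
  have e : 2 * (S / (c * s)) ^ (1 / δ) * genInv f s / (2 * genInv f s) =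
      (S / (c * s)) ^ (1 / δ) := by field_simp
  rw [e, ← Real.rpow_mul (by positivity), one_div_mul_cancel hδ.ne', Real.rpow_one] at hsc
  calc S = c * (S / (c * s)) * s := by field_simp
    _ ≤ c * (S / (c * s)) * f (2 * genInv f s) := by gcongr
    _ ≤ _ := hsc

theorem apply_genInv (h : LowerScaling f c δ) (hf : ContinuousOn f (Set.Ici 0)) (hs : 0 < s) :
    f (genInv f s) = s := by
  have hρ := h.genInv_pos hs
  have hcont : ContinuousAt f (genInv f s) := hf.continuousAt (Ici_mem_nhds hρ)
  refine le_antisymm ?_ ?_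
  · refine le_of_tendsto (hcont.tendsto.mono_left nhdsWithin_le_nhds)
      (x := nhdsWithin (genInv f s) (Set.Iio (genInv f s))) ?_
    filter_upwards [self_mem_nhdsWithin, mem_nhdsWithin_of_mem_nhds (Ioi_mem_nhds hρ)]
      with r hr hr0
    exact (lt_of_lt_genInv hr0 hr).le
  · refine ge_of_tendsto (hcont.tendsto.mono_left nhdsWithin_le_nhds)
      (x := nhdsWithin (genInv f s) (Set.Ioi (genInv f s))) ?_
    filter_upwards [self_mem_nhdsWithin] with r hr
    exact h.le_of_genInv_lt (hρ.trans hr) hr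

end LowerScaling

theorem genInv_apply (hf : StrictMonoOn f (Set.Ioi 0)) (hr : 0 < r) : genInv f (f r) = r :=
  le_antisymm (genInv_le hr le_rfl) <|
    le_csInf ⟨r, hr, le_rfl⟩ fun _ hr' => (hf.le_iff_le hr hr'.1).1 hr'.2

end GenInv

/-- Reverse volume doubling forces points to be null. -/
theorem measure_closedBall_zero_eq_zero {M : Type*} [MetricSpace M] [MeasurableSpace M]
    (μM : Measure M) (hVfin : ∀ (x : M) (r : ℝ), μM (Metric.closedBall x r) ≠ ⊤)
    {C₁ γ₁ : ℝ} (hC₁ : 0 < C₁) (hγ₁ : 0 < γ₁)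
    (hV : ∀ (x : M) (l r : ℝ), 1 < l → 0 < r →
      C₁⁻¹ * l ^ γ₁ * (μM (Metric.closedBall x r)).toReal ≤
        (μM (Metric.closedBall x (l * r))).toReal) (x : M) :
    (μM (Metric.closedBall x 0)).toReal = 0 := by
  by_contra hne
  have hpos : 0 < (μM (Metric.closedBall x 0)).toReal :=
    lt_of_le_of_ne ENNReal.toReal_nonneg (Ne.symm hne)
  have hbound : ∀ l : ℝ, 1 < l →
      l ^ γ₁ ≤ C₁ * (μM (Metric.closedBall x 1)).toReal / (μM (Metric.closedBall x 0)).toReal := by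
    intro l hl
    have hl0 : 0 < l := by linarith
    have h1 := hV x l (1 / l) hl (by positivity)
    rw [mul_one_div_cancel hl0.ne'] at h1
    have h2 : (μM (Metric.closedBall x 0)).toReal ≤ (μM (Metric.closedBall x (1 / l))).toReal :=
      ENNReal.toReal_mono (hVfin _ _)
        (measure_mono (Metric.closedBall_subset_closedBall (by positivity)))
    rw [le_div_iff₀ hpos]
    have h3 : C₁⁻¹ * l ^ γ₁ * (μM (Metric.closedBall x 0)).toReal ≤
        (μM (Metric.closedBall x 1)).toReal := le_trans (by gcongr) h1
    rw [mul_assoc, inv_mul_le_iff₀ hC₁] at h3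
    exact h3
  obtain ⟨l, hl, hl1⟩ := ((tendsto_rpow_atTop hγ₁).eventually_gt_atTop
    (C₁ * (μM (Metric.closedBall x 1)).toReal / (μM (Metric.closedBall x 0)).toReal)).and
      (Filter.eventually_gt_atTop 1) |>.exists
  exact (hbound l hl1).not_gt hl

/-- Near-diagonal upper bound for an integral against a law at its characteristic scale. -/
theorem lintegral_le_of_le_div {ν : Measure ℝ} {F q : ℝ → ℝ} {A B b S T : ℝ}
    (hFpos : ∀ s, 0 < s → 0 < F s) (hFmono : MonotoneOn F (Set.Ioi 0)) (hA : 1 ≤ A) (hB : 0 ≤ B)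
    (hF : ∀ s S : ℝ, 0 < s → s ≤ S → F S ≤ A * (S / s) ^ b * F s) (hT : 0 < T)
    (hS : ∫⁻ s in Set.Ioi 0, ENNReal.ofReal (max 1 ((T / s) ^ b)) ∂ν ≤ ENNReal.ofReal S)
    (hq : ∀ s, 0 < s → q s ≤ B / F s) :
    ∫⁻ s in Set.Ioi 0, ENNReal.ofReal (q s) ∂ν ≤ ENNReal.ofReal (B * A * S * (1 / F T)) := by
  have hFT := hFpos T hT
  have hpt : ∀ s ∈ Set.Ioi (0 : ℝ), ENNReal.ofReal (q s) ≤
      ENNReal.ofReal (B * A / F T) * ENNReal.ofReal (max 1 ((T / s) ^ b)) := by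
    intro s hs
    have hs' : 0 < s := hs
    have hFs := hFpos s hs
    have hmax : F T ≤ A * max 1 ((T / s) ^ b) * F s := by
      rcases le_total T s with hTs | hTs
      · have h1 : F T ≤ F s := hFmono hT hs hTs
        have h2 : 1 ≤ A * max 1 ((T / s) ^ b) := one_le_mul_of_one_le_of_one_le hA (le_max_left _ _)
        nlinarith
      · refine (hF s T hs hTs).trans ?_
        gcongr
        exact le_max_right _ _
    rw [← ENNReal.ofReal_mul (by positivity)]
    refine ENNReal.ofReal_le_ofReal ((hq s hs).trans ?_)
    rw [div_mul_eq_mul_div, div_le_div_iff₀ hFs hFT]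
    calc B * F T ≤ B * (A * max 1 ((T / s) ^ b) * F s) := by gcongr
      _ = _ := by ring
  calc ∫⁻ s in Set.Ioi 0, ENNReal.ofReal (q s) ∂ν
      ≤ ∫⁻ s in Set.Ioi 0,
          ENNReal.ofReal (B * A / F T) * ENNReal.ofReal (max 1 ((T / s) ^ b)) ∂ν :=
        setLIntegral_mono' measurableSet_Ioi hpt
    _ = ENNReal.ofReal (B * A / F T) *
          ∫⁻ s in Set.Ioi 0, ENNReal.ofReal (max 1 ((T / s) ^ b)) ∂ν :=
        lintegral_const_mul' _ _ ENNReal.ofReal_ne_top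
    _ ≤ ENNReal.ofReal (B * A / F T) * ENNReal.ofReal S := by gcongr
    _ = ENNReal.ofReal (B * A * S * (1 / F T)) := by
        rw [← ENNReal.ofReal_mul (by positivity)]
        congr 1
        ring

/-- Off-diagonal upper bound for an integral against a law with Laplace exponent `ψ`. -/
theorem HasLaplaceExponent.lintegral_le_of_le_one_sub_exp {ν : Measure ℝ} {ψ q : ℝ → ℝ}
    (h : HasLaplaceExponent ν ψ) {B l : ℝ} (hB : 0 ≤ B) (hl : 0 ≤ l)
    (hq : ∀ s, 0 < s → q s ≤ B * (1 - Real.exp (-l * s))) :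
    ∫⁻ s in Set.Ioi 0, ENNReal.ofReal (q s) ∂ν ≤ ENNReal.ofReal (B * ψ l) := by
  calc ∫⁻ s in Set.Ioi 0, ENNReal.ofReal (q s) ∂ν
      ≤ ∫⁻ s in Set.Ioi 0, ENNReal.ofReal B * ENNReal.ofReal (1 - Real.exp (-l * s)) ∂ν := by
        refine setLIntegral_mono' measurableSet_Ioi fun s hs => ?_
        rw [← ENNReal.ofReal_mul hB]
        exact ENNReal.ofReal_le_ofReal (hq s hs)
    _ ≤ ∫⁻ s, ENNReal.ofReal B * ENNReal.ofReal (1 - Real.exp (-l * s)) ∂ν :=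
        setLIntegral_le_lintegral _ _
    _ = ENNReal.ofReal B * ∫⁻ s, ENNReal.ofReal (1 - Real.exp (-l * s)) ∂ν :=
        lintegral_const_mul' _ _ ENNReal.ofReal_ne_top
    _ ≤ ENNReal.ofReal B * ENNReal.ofReal (ψ l) := by
        gcongr
        exact h.lintegral_one_sub_exp_le hl
    _ = ENNReal.ofReal (B * ψ l) := (ENNReal.ofReal_mul hB).symm

/-- Lower bound for an integral by the contribution of an annulus. -/
theorem le_lintegral_of_le_measureReal_Ico {ν : Measure ℝ} [IsFiniteMeasure ν] {q : ℝ → ℝ}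
    {a m r R : ℝ} (hr : 0 < r) (ha : 0 ≤ a) (hm : m ≤ ν.real (Set.Ico r R))
    (hq : ∀ s ∈ Set.Ico r R, a ≤ q s) :
    ENNReal.ofReal (a * m) ≤ ∫⁻ s in Set.Ioi 0, ENNReal.ofReal (q s) ∂ν := by
  calc ENNReal.ofReal (a * m) ≤ ENNReal.ofReal a * ν (Set.Ico r R) := by
        rw [ENNReal.ofReal_mul ha, ← ofReal_measureReal]
        gcongr
    _ = ∫⁻ _ in Set.Ico r R, ENNReal.ofReal a ∂ν := (setLIntegral_const _ _).symm
    _ ≤ ∫⁻ s in Set.Ico r R, ENNReal.ofReal (q s) ∂ν :=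
        setLIntegral_mono' measurableSet_Ico fun s hs => ENNReal.ofReal_le_ofReal (hq s hs)
    _ ≤ ∫⁻ s in Set.Ioi 0, ENNReal.ofReal (q s) ∂ν :=
        lintegral_mono_set fun s hs => hr.trans_le hs.1

theorem IsBernstein.monotoneOn {φ : ℝ → ℝ} (hφ : IsBernstein φ) : MonotoneOn φ (Set.Ici 0) := by
  obtain ⟨hcont, hdiff, -, hder⟩ := hφ
  refine monotoneOn_of_deriv_nonneg (convex_Ici 0) hcont ?_ ?_
  · rw [interior_Ici]
    exact hdiff.differentiableOn (by simp)
  · intro u hu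
    rw [interior_Ici] at hu
    simpa using hder 1 le_rfl u hu

theorem subordinated_subgaussian_two_sided_estimate
    {M : Type*} [MetricSpace M] [MeasurableSpace M] [BorelSpace M]
    (μM : Measure M)
    (hVfin : ∀ (x : M) (r : ℝ), μM (Metric.closedBall x r) ≠ ⊤)
    (hVpos : ∀ (x : M) (r : ℝ), 0 < r → 0 < (μM (Metric.closedBall x r)).toReal)
    (C₁ γ₁ γ₂ : ℝ) (hC₁ : 1 ≤ C₁) (hγ₁ : 0 < γ₁) (hγ₁₂ : γ₁ ≤ γ₂)
    (hVdoub : ∀ (x : M) (l r : ℝ), 1 < l → 0 < r →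
      C₁⁻¹ * l ^ γ₁ * (μM (Metric.closedBall x r)).toReal ≤
          (μM (Metric.closedBall x (l * r))).toReal ∧
        (μM (Metric.closedBall x (l * r))).toReal ≤
          C₁ * l ^ γ₂ * (μM (Metric.closedBall x r)).toReal)
    (f : ℝ → ℝ) (hf0 : f 0 = 0) (hfpos : ∀ r : ℝ, 0 < r → 0 < f r)
    (hfmono : StrictMonoOn f (Set.Ioi 0))
    (c₃ C₄ δ₁ δ₂ : ℝ) (hc₃0 : 0 < c₃) (hc₃1 : c₃ ≤ 1) (hC₄ : 1 ≤ C₄)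
    (hδ₁ : 0 < δ₁) (hδ₁₂ : δ₁ ≤ δ₂)
    (hfscal : ∀ r R : ℝ, 0 < r → r ≤ R →
      c₃ * (R / r) ^ δ₁ ≤ f R / f r ∧ f R / f r ≤ C₄ * (R / r) ^ δ₂)
    (g : ℝ → ℝ) (hg0 : g 0 = 0) (hgpos : ∀ r : ℝ, 0 < r → 0 < g r)
    (hgmono : StrictMonoOn g (Set.Ioi 0))
    (c₅ α : ℝ) (hc₅0 : 0 < c₅) (hc₅1 : c₅ ≤ 1) (hα : 0 < α)
    (hgscal : ∀ r R : ℝ, 0 < r → r ≤ R → c₅ * (R / r) ^ α ≤ g R / g r)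
    (C₂ : ℝ) (hC₂ : 1 ≤ C₂)
    (p : ℝ → M → M → ℝ)
    (hpmeas : Measurable fun q : ℝ × M × M => p q.1 q.2.1 q.2.2)
    (hp : ∀ (s : ℝ), 0 < s → ∀ x y : M,
      C₂⁻¹ * (if f (dist x y) ≤ s then (1 : ℝ) else 0) /
          (μM (Metric.closedBall x (genInv f s))).toReal ≤ p s x y ∧
        p s x y ≤ C₂ * Real.exp (-g (f (dist x y) / s)) /
          (μM (Metric.closedBall x (genInv f s))).toReal)
    (φ : ℝ → ℝ) (hφ : IsBernstein φ) (hφ0 : φ 0 = 0)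
    (β₁ β₂ c₇ C₆ : ℝ) (hβ₁ : 0 < β₁) (hβ₁₂ : β₁ < β₂) (hβ₂ : β₂ < 1)
    (hc₇0 : 0 < c₇) (hc₇1 : c₇ ≤ 1) (hC₆ : 1 ≤ C₆)
    (hφup : ∀ l : ℝ, 0 < l → l ≤ 1 → ∀ θ : ℝ, 0 < θ → c₇ * l ^ β₂ * φ θ ≤ φ (l * θ))
    (hφlo : ∀ l : ℝ, 0 < l → l ≤ 1 → ∀ θ : ℝ, 0 < θ → φ (l * θ) ≤ C₆ * l ^ β₁ * φ θ)
    (μ : ℝ → Measure ℝ) (hμ : IsSubordinatorLaw φ μ) :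
    ∃ c C : ℝ, 0 < c ∧ c ≤ C ∧
      ∀ t : ℝ, 0 < t → ∀ x y : M,
        ENNReal.ofReal (c *
            (if x = y then
              1 / (μM (Metric.closedBall x (genInv f (1 / genInv φ (1 / t))))).toReal
            else
              min (1 / (μM (Metric.closedBall x (genInv f (1 / genInv φ (1 / t))))).toReal)
                (t * φ (1 / f (dist x y)) /
                  (μM (Metric.closedBall x (dist x y))).toReal))) ≤
          (∫⁻ s in Set.Ioi (0 : ℝ), ENNReal.ofReal (p s x y) ∂μ t) ∧
        (∫⁻ s in Set.Ioi (0 : ℝ), ENNReal.ofReal (p s x y) ∂μ t) ≤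
          ENNReal.ofReal (C *
            (if x = y then
              1 / (μM (Metric.closedBall x (genInv f (1 / genInv φ (1 / t))))).toReal
            else
              min (1 / (μM (Metric.closedBall x (genInv f (1 / genInv φ (1 / t))))).toReal)
                (t * φ (1 / f (dist x y)) /
                  (μM (Metric.closedBall x (dist x y))).toReal))) := by
  have hC₁0 : 0 < C₁ := by linarith
  have hC₂0 : 0 < C₂ := by linarith
  have hC₆0 : 0 < C₆ := by linarith
  have hβ₂0 : 0 < β₂ := hβ₁.trans hβ₁₂
  have hγ₂ : 0 < γ₂ := hγ₁.trans_le hγ₁₂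
  have hφmono := hφ.monotoneOn
  have hlaw : ∀ t : ℝ, 0 < t → HasLaplaceExponent (μ t) fun l => t * φ l := fun t ht => by
    obtain ⟨h1, h2, h3⟩ := hμ t ht
    exact ⟨h1, h2, fun l hl => by rw [h3 l hl, neg_mul]⟩
  have hf : LowerScaling f c₃ δ₁ := by
    refine ⟨hc₃0, hδ₁, hfpos, hfmono.monotoneOn, fun r R hr hrR => ?_⟩
    have := (hfscal r R hr hrR).1
    rwa [le_div_iff₀ (hfpos r hr)] at this
  by_cases hφ1 : φ 1 = 0
  · have hφz : ∀ θ : ℝ, 0 < θ → φ θ = 0 := by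
      intro θ hθ
      refine le_antisymm ?_ (hφ.2.2.1 θ hθ.le)
      rcases le_total θ 1 with h | h
      · exact hφ1 ▸ hφmono hθ.le (Set.mem_Ici.2 zero_le_one) h
      · have := hφup (1 / θ) (by positivity) ((div_le_one hθ).2 h) θ hθ
        rw [one_div_mul_cancel hθ.ne', hφ1] at this
        have hpos : 0 < c₇ * (1 / θ) ^ β₂ := by positivity
        exact nonpos_of_mul_nonpos_right this hpos
    refine ⟨1, 1, one_pos, le_rfl, fun t ht x y => ?_⟩
    have hinv : genInv φ (1 / t) = 0 := by
      have : {r : ℝ | 0 < r ∧ 1 / t ≤ φ r} = ∅ := by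
        ext r
        simp only [Set.mem_ofPred_eq, Set.mem_empty_iff_false, iff_false, not_and, not_le]
        intro hr
        rw [hφz r hr]
        positivity
      rw [genInv, this, Real.sInf_empty]
    have hinv0 : genInv f (1 / 0) = 0 := by
      refine le_antisymm (le_of_forall_pos_le_add fun ε hε => ?_)
        (Real.sInf_nonneg fun r hr => hr.1.le)
      rw [zero_add]
      exact genInv_le hε (by simpa using (hfpos ε hε).le)
    have hnull := measure_closedBall_zero_eq_zero μM hVfin hC₁0 hγ₁
      (fun x l r hl hr => (hVdoub x l r hl hr).1) x
    have hint : ∫⁻ s in Set.Ioi (0 : ℝ), ENNReal.ofReal (p s x y) ∂μ t = 0 :=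
      setLIntegral_measure_zero _ _ ((hlaw t ht).measure_Ioi_eq_zero (by simp [hφ1]))
    rw [hint, hinv, hinv0, hnull]
    refine ⟨?_, zero_le⟩
    rw [nonpos_iff_eq_zero, ENNReal.ofReal_eq_zero]
    split_ifs with hxy
    · simp
    · rw [hφz _ (one_div_pos.2 (hfpos _ (dist_pos.2 hxy)))]
      simp
  have hφpos : ∀ θ : ℝ, 0 < θ → 0 < φ θ := by
    have h1 : 0 < φ 1 := lt_of_le_of_ne (hφ.2.2.1 1 (Set.mem_Ici.2 zero_le_one)) (Ne.symm hφ1)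
    intro θ hθ
    rcases le_total θ 1 with h | h
    · have := hφup θ hθ h 1 one_pos
      rw [mul_one] at this
      exact lt_of_lt_of_le (by positivity) this
    · exact h1.trans_le (hφmono (Set.mem_Ici.2 zero_le_one) hθ.le h)
  have hφls : LowerScaling φ C₆⁻¹ β₁ := by
    refine ⟨by positivity, hβ₁, hφpos, hφmono.mono Set.Ioi_subset_Ici_self, fun r R hr hrR => ?_⟩
    have hR : 0 < R := hr.trans_le hrR
    have := hφlo (r / R) (by positivity) ((div_le_one hR).2 hrR) R hR
    rw [div_mul_cancel₀ _ hR.ne'] at this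
    have hpow : (R / r) ^ β₁ * (r / R) ^ β₁ = 1 := by
      rw [← Real.mul_rpow (by positivity) (by positivity), div_mul_div_cancel₀ hr.ne',
        div_self hR.ne', Real.one_rpow]
    calc C₆⁻¹ * (R / r) ^ β₁ * φ r ≤ C₆⁻¹ * (R / r) ^ β₁ * (C₆ * (r / R) ^ β₁ * φ R) := by gcongr
      _ = (C₆⁻¹ * C₆) * ((R / r) ^ β₁ * (r / R) ^ β₁) * φ R := by ring
      _ = φ R := by rw [hpow, inv_mul_cancel₀ hC₆0.ne']; ring
  set V : M → ℝ → ℝ := fun x r => (μM (Metric.closedBall x r)).toReal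
  have hVmono : ∀ (x : M) {r R : ℝ}, r ≤ R → V x r ≤ V x R := fun x r R hrR =>
    ENNReal.toReal_mono (hVfin _ _) (measure_mono (Metric.closedBall_subset_closedBall hrR))
  set F : M → ℝ → ℝ := fun x s => V x (genInv f s)
  have hFpos : ∀ x s, 0 < s → 0 < F x s := fun x s hs => hVpos x _ (hf.genInv_pos hs)
  have hFmono : ∀ x, MonotoneOn (F x) (Set.Ioi 0) := fun x s _ S _ hsS =>
    hVmono x (hf.genInv_mono hsS)
  obtain ⟨A, b, hA, hb, hF⟩ : ∃ A b : ℝ, 1 ≤ A ∧ 0 ≤ b ∧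
      ∀ (x : M) (s S : ℝ), 0 < s → s ≤ S → F x S ≤ A * (S / s) ^ b * F x s := by
    have hcinv : 1 ≤ c₃⁻¹ := (one_le_inv₀ hc₃0).2 hc₃1
    have hA' : 1 ≤ (2 * c₃⁻¹ ^ (1 / δ₁)) ^ γ₂ := by
      refine Real.one_le_rpow ?_ hγ₂.le
      have : 1 ≤ c₃⁻¹ ^ (1 / δ₁) := Real.one_le_rpow hcinv (by positivity)
      linarith
    refine ⟨C₁ * (2 * c₃⁻¹ ^ (1 / δ₁)) ^ γ₂, 1 / δ₁ * γ₂,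
      one_le_mul_of_one_le_of_one_le hC₁ hA', by positivity, fun x s S hs hsS => ?_⟩
    have hS : 0 < S := hs.trans_le hsS
    have hl : 1 < 2 * (S / (c₃ * s)) ^ (1 / δ₁) := by
      have : 1 ≤ (S / (c₃ * s)) ^ (1 / δ₁) :=
        Real.one_le_rpow ((one_le_div (by positivity)).2 (by nlinarith)) (by positivity)
      linarith
    have h1 := hVmono x (hf.genInv_le_mul hc₃1 hs hsS)
    have h2 := (hVdoub x _ _ hl (hf.genInv_pos hs)).2
    refine (h1.trans h2).trans_eq ?_
    have e : S / (c₃ * s) = c₃⁻¹ * (S / s) := by field_simp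
    have e2 : (c₃⁻¹ * (S / s)) ^ (1 / δ₁) = c₃⁻¹ ^ (1 / δ₁) * (S / s) ^ (1 / δ₁) :=
      Real.mul_rpow (by positivity) (by positivity)
    rw [e, e2, ← mul_assoc, Real.mul_rpow (by positivity) (by positivity),
      ← Real.rpow_mul (by positivity), ← mul_assoc]
  have hA0 : 0 < A := by linarith
  obtain ⟨K, a, hK, ha, hann⟩ := exists_le_measureReal_Ico hβ₁ hβ₂0 hβ₂ hc₇0 hc₇1 hC₆
  obtain ⟨S, hS, hmom⟩ := exists_lintegral_negative_moment_le b hb hβ₁ (hβ₁₂.trans hβ₂).le hC₆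
  obtain ⟨B, hB, hoff⟩ := exists_exp_neg_div_le (b := b) hgpos hc₅0 hα hgscal hA0
  have hK0 : 0 < K := by linarith
  set c := a / (C₂ * (A * K ^ b)) with hc
  have hc0 : 0 < c := by positivity
  refine ⟨c, max c (max (C₂ * A * S) (C₂ * B)), hc0, le_max_left _ _, fun t ht x y => ?_⟩
  have hL := hlaw t ht
  have hprob := hL.isProbabilityMeasure
  have hθ := hφls.genInv_pos (one_div_pos.2 ht)
  have hφθ := hφls.apply_genInv hφ.1 (one_div_pos.2 ht)
  have hup' : ∀ l : ℝ, 0 < l → l ≤ 1 → ∀ θ : ℝ, 0 < θ →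
      c₇ * l ^ β₂ * (t * φ θ) ≤ t * φ (l * θ) := fun l hl hl1 θ hθ => by
    have := mul_le_mul_of_nonneg_left (hφup l hl hl1 θ hθ) ht.le
    linarith
  have hlo' : ∀ l : ℝ, 0 < l → l ≤ 1 → ∀ θ : ℝ, 0 < θ →
      t * φ (l * θ) ≤ C₆ * l ^ β₁ * (t * φ θ) := fun l hl hl1 θ hθ => by
    have := mul_le_mul_of_nonneg_left (hφlo l hl hl1 θ hθ) ht.le
    linarith
  set T := 1 / genInv φ (1 / t) with hTdef
  have hT : 0 < T := by positivity
  have hTφ : t * φ (1 / T) = 1 := by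
    rw [hTdef, one_div_one_div, hφθ, mul_one_div_cancel ht.ne']
  have hlower : ∀ r : ℝ, 0 < r → f (dist x y) ≤ r → t * φ (1 / r) ≤ 1 →
      ENNReal.ofReal (c * (t * φ (1 / r) / F x r)) ≤
        ∫⁻ s in Set.Ioi (0 : ℝ), ENNReal.ofReal (p s x y) ∂μ t := by
    intro r hr hDr hr1
    have hFr := hFpos x r hr
    have hm := hann _ _ hL (fun θ hθ => mul_pos ht (hφpos θ hθ))
      (fun u hu v hv huv => mul_le_mul_of_nonneg_left (hφmono hu hv huv) ht.le) hup' hlo' r hr hr1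
    have key := le_lintegral_of_le_measureReal_Ico (q := fun s => p s x y)
      (a := C₂⁻¹ / (A * K ^ b * F x r)) hr (by positivity) hm ?_
    · refine le_trans (le_of_eq ?_) key
      congr 1
      rw [hc]
      field_simp
    · intro s hs
      have hs0 : 0 < s := hr.trans_le hs.1
      have h1 := (hp s hs0 x y).1
      rw [if_pos (hDr.trans hs.1), mul_one] at h1
      refine le_trans ?_ h1
      have h2 : F x s ≤ A * (s / r) ^ b * F x r := hF x r s hr hs.1
      have h3 : s / r ≤ K := (div_le_iff₀ hr).2 hs.2.le
      refine div_le_div_of_nonneg_left (by positivity) (hFpos x s hs0) (h2.trans ?_)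
      gcongr
  have hnear : ∫⁻ s in Set.Ioi (0 : ℝ), ENNReal.ofReal (p s x y) ∂μ t ≤
      ENNReal.ofReal (C₂ * A * S * (1 / F x T)) := by
    refine lintegral_le_of_le_div (hFpos x) (hFmono x) hA hC₂0.le (hF x) hT
      (hmom _ _ hL (by simp [hφ0]) hlo' T hT hTφ) fun s hs => ?_
    refine (hp s hs x y).2.trans ?_
    have hFs := hFpos x s hs
    have hgnn : 0 ≤ g (f (dist x y) / s) := by
      rcases eq_or_ne x y with rfl | hxy
      · simp [hf0, hg0]
      · exact (hgpos _ (div_pos (hfpos _ (dist_pos.2 hxy)) hs)).le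
    have h1 : Real.exp (-g (f (dist x y) / s)) ≤ 1 := Real.exp_le_one_iff.2 (by linarith)
    refine div_le_div_of_nonneg_right ?_ hFs.le
    exact mul_le_of_le_one_right hC₂0.le h1
  have hCc : C₂ * A * S ≤ max c (max (C₂ * A * S) (C₂ * B)) :=
    (le_max_left _ _).trans (le_max_right _ _)
  have hCB : C₂ * B ≤ max c (max (C₂ * A * S) (C₂ * B)) :=
    (le_max_right _ _).trans (le_max_right _ _)
  have hFT := hFpos x T hT
  have hdiagLower : f (dist x y) ≤ T → ENNReal.ofReal (c * (1 / F x T)) ≤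
      ∫⁻ s in Set.Ioi (0 : ℝ), ENNReal.ofReal (p s x y) ∂μ t := fun hD => by
    have := hlower T hT hD hTφ.le
    rwa [hTφ] at this
  have hdiagUpper : ∫⁻ s in Set.Ioi (0 : ℝ), ENNReal.ofReal (p s x y) ∂μ t ≤
      ENNReal.ofReal (max c (max (C₂ * A * S) (C₂ * B)) * (1 / F x T)) :=
    hnear.trans (ENNReal.ofReal_le_ofReal (by gcongr))
  rcases eq_or_ne x y with hxy | hxy
  · rw [if_pos hxy]
    exact ⟨hdiagLower (by simpa [hxy, hf0] using hT.le), hdiagUpper⟩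
  rw [if_neg hxy]
  have hdist : 0 < dist x y := dist_pos.2 hxy
  have hD := hfpos _ hdist
  have hFD : V x (dist x y) = F x (f (dist x y)) := by
    simp only [F, genInv_apply hfmono hdist]
  have hFD0 := hFpos x _ hD
  change ENNReal.ofReal (c * min (1 / F x T) (t * φ (1 / f (dist x y)) / V x (dist x y))) ≤ _ ∧
    _ ≤ ENNReal.ofReal (_ * min (1 / F x T) (t * φ (1 / f (dist x y)) / V x (dist x y)))
  rw [hFD]
  set D := f (dist x y)
  constructor
  · rcases le_or_gt D T with hDT | hDT
    · refine le_trans (ENNReal.ofReal_le_ofReal ?_) (hdiagLower hDT)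
      gcongr
      exact min_le_left _ _
    · have h1 : t * φ (1 / D) ≤ 1 := by
        refine le_trans ?_ hTφ.le
        refine mul_le_mul_of_nonneg_left (hφmono ?_ ?_ ?_) ht.le
        · exact (one_div_pos.2 hD).le
        · exact (one_div_pos.2 hT).le
        · exact one_div_le_one_div_of_le hT hDT.le
      refine le_trans (ENNReal.ofReal_le_ofReal ?_) (hlower D hD le_rfl h1)
      gcongr
      exact min_le_right _ _
  · have hfar : ∫⁻ s in Set.Ioi (0 : ℝ), ENNReal.ofReal (p s x y) ∂μ t ≤
        ENNReal.ofReal (max c (max (C₂ * A * S) (C₂ * B)) * (t * φ (1 / D) / F x D)) := by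
      have h1 := hL.lintegral_le_of_le_one_sub_exp (q := fun s => p s x y) (l := 1 / D)
        (B := C₂ * (B / F x D)) (by positivity) (by positivity) fun s hs => by
          refine (hp s hs x y).2.trans ?_
          rw [mul_div_assoc, mul_assoc]
          exact mul_le_mul_of_nonneg_left
            (hoff (F x) (hFpos x) (hFmono x) (hF x) s D hs hD) hC₂0.le
      refine h1.trans (ENNReal.ofReal_le_ofReal ?_)
      have hφD := hφpos (1 / D) (by positivity)
      calc C₂ * (B / F x D) * (t * φ (1 / D)) = C₂ * B * (t * φ (1 / D) / F x D) := by ring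
        _ ≤ _ := by gcongr
    rcases min_choice (1 / F x T) (t * φ (1 / D) / F x D) with h | h <;> rw [h]
    · exact hdiagUpper
    · exact hfar
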